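/- The position value does not satisfy balanced conference contributions: for N={1,2,3,4,5,6}, v=u_{{1,2,3}} the unanimity game (v(S)=1 if {1,2,3}⊆S, else 0), and H={{1,4},{2,5},{3,6},{4,5,6}}, one has Σ_{e∈H_6}[π_1(N,v,H)−π_1(N,v,H\{e})] = 1/4, whereas Σ_{e∈H_1}[π_6(N,v,H)−π_6(N,v,H\{e})] = 5/24, and these two quantities are not equal. -/

import Mathlib

open scoped Classical
open Finset

noncomputable section

namespace HGGame

/-! ## Generic hypergraph notions -/

variable {α : Type*}

/-- Two nodes are linked if they lie in a common hyperlink of `E`. -/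
def Linked (E : Finset (Finset α)) (a b : α) : Prop :=
  ∃ e ∈ E, a ∈ e ∧ b ∈ e

/-- The component of `i` in the subhypergraph of `(α, E)` induced by the ground set `S`
(only hyperlinks contained in `S` count). -/
def compOf (E : Finset (Finset α)) (S : Finset α) (i : α) : Finset α :=
  S.filter (fun j => Relation.ReflTransGen (Linked (E.filter (fun e => e ⊆ S))) i j)

/-- The set `S/E` of components of the subhypergraph induced by `S`. -/
def components (E : Finset (Finset α)) (S : Finset α) : Finset (Finset α) :=
  S.image (compOf E S)

/-- The hypergraph-restricted worth `v^E(S) = Σ_{T ∈ S/E} v(T)`. -/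
def restrictedWorth (v : Finset α → ℝ) (E : Finset (Finset α)) (S : Finset α) : ℝ :=
  ∑ T ∈ components E S, v T

/-! ## Shapley value -/

/-- The set `σ^i` of players preceding `i` in the ordering `σ`. -/
def preceding {M : Type*} [Fintype M] (σ : M ≃ Fin (Fintype.card M)) (i : M) : Finset M :=
  Finset.univ.filter (fun j => σ j < σ i)

/-- The marginal contribution `m^σ_i(u) = u(σ^i ∪ {i}) - u(σ^i)`. -/
def marginal {M : Type*} [Fintype M] (u : Finset M → ℝ) (σ : M ≃ Fin (Fintype.card M))
    (i : M) : ℝ :=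
  u (insert i (preceding σ i)) - u (preceding σ i)

/-- The Shapley value of the TU-game `(M, u)`. -/
def shapley {M : Type*} [Fintype M] (u : Finset M → ℝ) (i : M) : ℝ :=
  ((Fintype.card M).factorial : ℝ)⁻¹ * ∑ σ : M ≃ Fin (Fintype.card M), marginal u σ i

/-- The Harsanyi dividend `λ_T(u) = Σ_{∅ ≠ S ⊆ T} (-1)^{|T|-|S|} u(S)`. -/
def dividend {M : Type*} (u : Finset M → ℝ) (T : Finset M) : ℝ :=
  ∑ S ∈ T.powerset.filter (fun S => S ≠ ∅), (-1 : ℝ) ^ (T.card - S.card) * u S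

/-! ## Hypergraph communication situations -/

variable {N : Type*} [Fintype N] [DecidableEq N]

/-- The conference game `(H, v^N)`, a TU-game with player set `H`:
`v^N(H') = Σ_{T ∈ N/H'} v(T)`. -/
def confGame (v : Finset N → ℝ) (H : Finset (Finset N)) (F : Finset {e // e ∈ H}) : ℝ :=
  restrictedWorth v (F.image Subtype.val) Finset.univ

/-- The position value `π_i(N,v,H) = Σ_{e ∈ H_i} (1/|e|) · Sh_e(H, v^N)`. -/
def positionValue (v : Finset N → ℝ) (H : Finset (Finset N)) (i : N) : ℝ :=
  ∑ e ∈ H.attach.filter (fun e => i ∈ e.val),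
    ((e.val.card : ℝ))⁻¹ * shapley (confGame v H) e

/-! ## The uniform hyperlink game -/

/-- The type of agents `(i, e, k)` of the uniform hyperlink game. -/
abbrev UElem (N : Type*) := N × Finset N × ℕ

/-- `η(H)`: the least common multiple of the hyperlink sizes. -/
def eta (H : Finset (Finset N)) : ℕ := H.lcm Finset.card

/-- `U(H)(i,e) = {(i,e,k) : k = 1, …, η(H)/|e|}`. -/
def UHie (H : Finset (Finset N)) (i : N) (e : Finset N) : Finset (UElem N) :=
  (Finset.Icc 1 (eta H / e.card)).image fun k => (i, e, k)

/-- `U(H)(i) = ∪_{e ∈ H_i} U(H)(i,e)`. -/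
def UHi (H : Finset (Finset N)) (i : N) : Finset (UElem N) :=
  (H.filter (fun e => i ∈ e)).biUnion fun e => UHie H i e

/-- `U(H)(e) = ∪_{i ∈ e} U(H)(i,e)`. -/
def UHe (H : Finset (Finset N)) (e : Finset N) : Finset (UElem N) :=
  e.biUnion fun i => UHie H i e

/-- `U(H) = ∪_{i ∈ N} U(H)(i)`. -/
def UH (H : Finset (Finset N)) : Finset (UElem N) :=
  Finset.univ.biUnion fun i : N => UHi H i

/-- `H[S] = {e ∈ H : U(H)(e) ⊆ S}`. -/
def Hof (H : Finset (Finset N)) (S : Finset (UElem N)) : Finset (Finset N) :=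
  H.filter fun e => UHe H e ⊆ S

/-- The characteristic function `w(S) = Σ_{R ∈ N/H[S]} v(R)` of the uniform hyperlink game. -/
def uw (v : Finset N → ℝ) (H : Finset (Finset N)) (S : Finset (UElem N)) : ℝ :=
  restrictedWorth v (Hof H S) Finset.univ

/-- The uniform hyperlink game `(U(H), w)` as a TU-game with player set `U(H)`. -/
def uGame (v : Finset N → ℝ) (H : Finset (Finset N)) (F : Finset {l // l ∈ UH H}) : ℝ :=
  uw v H (F.image Subtype.val)

/-- The unanimity game `u_{{1,2,3}}` on six players (players `1,…,6` encoded as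
`0,…,5 : Fin 6`). -/
def exV : Finset (Fin 6) → ℝ := fun S => if ({0, 1, 2} : Finset (Fin 6)) ⊆ S then 1 else 0

/-- The hyperlink set `H = {{1,4},{2,5},{3,6},{4,5,6}}` (players shifted down by one). -/
def exH : Finset (Finset (Fin 6)) :=
  {({0, 3} : Finset (Fin 6)), {1, 4}, {2, 5}, {3, 4, 5}}

/-- A set of nodes that no hyperlink crosses is closed under connectedness. -/
lemma mem_iff_of_connected {E : Finset (Finset α)} {S : Set α}
    (hS : ∀ e ∈ E, ∀ a ∈ e, ∀ b ∈ e, a ∈ S → b ∈ S) {i j : α}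
    (h : Relation.ReflTransGen (Linked E) i j) : i ∈ S ↔ j ∈ S := by
  induction h with
  | refl => rfl
  | tail _ hbc ih =>
    obtain ⟨e, he, hb, hc⟩ := hbc
    exact ih.trans ⟨hS e he _ hb _ hc, hS e he _ hc _ hb⟩

lemma mem_compOf_univ [Fintype α] {E : Finset (Finset α)} {i j : α} :
    j ∈ compOf E Finset.univ i ↔ Relation.ReflTransGen (Linked E) i j := by
  simp [compOf]

lemma mem_components {E : Finset (Finset α)} {S T : Finset α} :
    T ∈ components E S ↔ ∃ i ∈ S, compOf E S i = T :=
  Finset.mem_image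

/-- If no hyperlink crosses a set separating two of the players `0, 1, 2`, then no component
is winning in the unanimity game `exV`. -/
lemma restrictedWorth_exV_eq_zero {E : Finset (Finset (Fin 6))} (S : Set (Fin 6))
    (hS : ∀ e ∈ E, ∀ a ∈ e, ∀ b ∈ e, a ∈ S → b ∈ S) {p q : Fin 6}
    (hp : p ∈ ({0, 1, 2} : Finset (Fin 6))) (hq : q ∈ ({0, 1, 2} : Finset (Fin 6)))
    (hpS : p ∈ S) (hqS : q ∉ S) : restrictedWorth exV E Finset.univ = 0 := by
  refine Finset.sum_eq_zero fun T hT => ?_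
  obtain ⟨i, -, rfl⟩ := mem_components.1 hT
  refine if_neg fun hsub => hqS ?_
  have hip := mem_iff_of_connected hS (mem_compOf_univ.1 (hsub hp))
  have hiq := mem_iff_of_connected hS (mem_compOf_univ.1 (hsub hq))
  exact hiq.1 (hip.2 hpS)

lemma restrictedWorth_exV_of_subset_erase {E : Finset (Finset (Fin 6))} {e : Finset (Fin 6)}
    (he : e ∈ exH) (hE : E ⊆ exH.erase e) : restrictedWorth exV E Finset.univ = 0 := by
  have key : ∀ d ∈ E, d ∈ exH ∧ d ≠ e := fun d hd =>
    ⟨Finset.mem_of_mem_erase (hE hd), Finset.ne_of_mem_erase (hE hd)⟩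
  simp only [exH, Finset.mem_insert, Finset.mem_singleton] at he key
  rcases he with rfl | rfl | rfl | rfl
  · refine restrictedWorth_exV_eq_zero {0} (fun d hd => ?_) (p := 0) (q := 1)
      (by simp) (by simp) (by simp) (by simp)
    rcases key d hd with ⟨rfl | rfl | rfl | rfl, hne⟩ <;> simp at hne ⊢
  · refine restrictedWorth_exV_eq_zero {1} (fun d hd => ?_) (p := 1) (q := 0)
      (by simp) (by simp) (by simp) (by simp)
    rcases key d hd with ⟨rfl | rfl | rfl | rfl, hne⟩ <;> simp at hne ⊢
  · refine restrictedWorth_exV_eq_zero {2} (fun d hd => ?_) (p := 2) (q := 0)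
      (by simp) (by simp) (by simp) (by simp)
    rcases key d hd with ⟨rfl | rfl | rfl | rfl, hne⟩ <;> simp at hne ⊢
  · refine restrictedWorth_exV_eq_zero {0, 3} (fun d hd => ?_) (p := 0) (q := 1)
      (by simp) (by simp) (by simp) (by simp)
    rcases key d hd with ⟨rfl | rfl | rfl | rfl, hne⟩ <;> simp at hne ⊢

instance linked_symm {E : Finset (Finset α)} : Std.Symm (Linked E) :=
  ⟨fun _ _ ⟨e, he, ha, hb⟩ => ⟨e, he, hb, ha⟩⟩

lemma connected_exH_three (i : Fin 6) : Relation.ReflTransGen (Linked exH) 3 i := by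
  have step {a b : Fin 6} (e : Finset (Fin 6)) (he : e ∈ exH) (ha : a ∈ e) (hb : b ∈ e) :
      Relation.ReflTransGen (Linked exH) a b := .single ⟨e, he, ha, hb⟩
  have h34 := step (a := 3) (b := 4) {3, 4, 5} (by simp [exH]) (by simp) (by simp)
  have h35 := step (a := 3) (b := 5) {3, 4, 5} (by simp [exH]) (by simp) (by simp)
  fin_cases i
  · exact step {0, 3} (by simp [exH]) (by simp) (by simp)
  · exact h34.trans (step {1, 4} (by simp [exH]) (by simp) (by simp))
  · exact h35.trans (step {2, 5} (by simp [exH]) (by simp) (by simp))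
  · exact .refl
  · exact h34
  · exact h35

lemma restrictedWorth_exV_exH : restrictedWorth exV exH Finset.univ = 1 := by
  have hcomp : ∀ i, compOf exH Finset.univ i = Finset.univ := fun i => by
    ext j
    have hi3 : Relation.ReflTransGen (Linked exH) i 3 :=
      symm_of _ (connected_exH_three i)
    simpa [mem_compOf_univ] using hi3.trans (connected_exH_three j)
  have : components exH Finset.univ = {Finset.univ} := by
    ext T
    simp [mem_components, hcomp, eq_comm]
  rw [restrictedWorth, this, Finset.sum_singleton, exV, if_pos (Finset.subset_univ _)]

/-- All four hyperlinks are needed to connect the players `0, 1, 2`. -/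
lemma confGame_exV_exH (F : Finset {e // e ∈ exH}) :
    confGame exV exH F = if F = Finset.univ then 1 else 0 := by
  split_ifs with hF
  · subst hF
    have : (Finset.univ : Finset {e // e ∈ exH}).image Subtype.val = exH := by
      ext; simp
    rw [confGame, this, restrictedWorth_exV_exH]
  · obtain ⟨e, he⟩ : ∃ e, e ∉ F := by
      by_contra! h
      exact hF (Finset.eq_univ_iff_forall.2 h)
    refine restrictedWorth_exV_of_subset_erase e.2 fun d hd => ?_
    obtain ⟨d, hdF, rfl⟩ := Finset.mem_image.1 hd
    exact Finset.mem_erase.2 ⟨fun h => he (Subtype.ext h ▸ hdF), d.2⟩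

lemma positionValue_exV_erase {e : Finset (Fin 6)} (he : e ∈ exH) (i : Fin 6) :
    positionValue exV (exH.erase e) i = 0 := by
  have h : confGame exV (exH.erase e) = fun _ => 0 := funext fun F =>
    restrictedWorth_exV_of_subset_erase he fun d hd => by
      obtain ⟨d, -, rfl⟩ := Finset.mem_image.1 hd
      exact d.2
  simp [positionValue, h, shapley, marginal]

lemma marginal_unanimity_univ {M : Type*} [Fintype M] (σ : M ≃ Fin (Fintype.card M)) (i : M) :
    marginal (fun F => if F = Finset.univ then 1 else 0) σ i =
      if ∀ j, σ j ≤ σ i then 1 else 0 := by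
  have h₁ : preceding σ i ≠ Finset.univ := fun h => by
    have := h ▸ Finset.mem_univ i
    simp [preceding] at this
  have h₂ : insert i (preceding σ i) = Finset.univ ↔ ∀ j, σ j ≤ σ i := by
    simp [Finset.eq_univ_iff_forall, preceding, le_iff_eq_or_lt]
  simp [marginal, h₁, h₂]

lemma sum_marginal_unanimity_univ {M : Type*} [Fintype M] [Nonempty M]
    (σ : M ≃ Fin (Fintype.card M)) :
    ∑ i, marginal (fun F => if F = Finset.univ then 1 else 0) σ i = 1 := by
  simp only [marginal_unanimity_univ]
  obtain ⟨m, hm⟩ := Finite.exists_max σ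
  rw [Finset.sum_eq_single m, if_pos hm]
  · exact fun i _ hi => if_neg fun h => hi (σ.injective ((hm i).antisymm (h m)))
  · simp

lemma sum_marginal_unanimity_univ_congr {M : Type*} [Fintype M] (i j : M) :
    ∑ σ, marginal (fun F => if F = Finset.univ then 1 else 0) σ i =
      ∑ σ, marginal (fun F => if F = Finset.univ then 1 else 0) σ j := by
  rw [← Equiv.sum_comp (Equiv.equivCongr (Equiv.swap i j) (Equiv.refl _))]
  refine Finset.sum_congr rfl fun σ _ => ?_
  simp only [marginal_unanimity_univ]
  congr 1
  simpa using (Equiv.swap i j).forall_congr_left (p := fun k => σ (Equiv.swap i j k) ≤ σ j)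

/-- The Shapley value shares the worth of the unanimity game on the grand coalition equally. -/
lemma shapley_unanimity_univ {M : Type*} [Fintype M] (i : M) :
    shapley (fun F => if F = Finset.univ then 1 else 0) i = (Fintype.card M : ℝ)⁻¹ := by
  have : Nonempty M := ⟨i⟩
  have hcard : (Fintype.card M : ℝ) ≠ 0 := by simp
  have hfac : ((Fintype.card M).factorial : ℝ) ≠ 0 := by positivity
  have htotal : (Fintype.card M : ℝ) *
      ∑ σ, marginal (fun F : Finset M => if F = Finset.univ then 1 else 0) σ i =
        (Fintype.card M).factorial := by
    calc _ = ∑ j : M, ∑ σ, marginal (fun F => if F = Finset.univ then 1 else 0) σ j := by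
          simp [sum_marginal_unanimity_univ_congr _ i]
      _ = _ := by
          rw [Finset.sum_comm]
          simp [sum_marginal_unanimity_univ, Fintype.card_equiv (Fintype.equivFin M)]
  rw [shapley]
  field_simp
  linarith

lemma card_exH : exH.card = 4 := by
  simp only [exH]
  decide

lemma positionValue_exV_exH (i : Fin 6) :
    positionValue exV exH i = ∑ e ∈ exH with i ∈ e, (e.card : ℝ)⁻¹ * (1 / 4) := by
  have hsh (e : {e // e ∈ exH}) : shapley (confGame exV exH) e = 1 / 4 := by
    have hcard : (Fintype.card {e // e ∈ exH} : ℝ)⁻¹ = 1 / 4 := by simp [card_exH]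
    rw [← hcard, ← shapley_unanimity_univ e]
    congr 1
    funext F
    convert confGame_exV_exH F
  simp only [positionValue, hsh, Finset.sum_filter]
  exact Finset.sum_attach exH fun e => if i ∈ e then (e.card : ℝ)⁻¹ * (1 / 4) else 0

lemma filter_zero_mem_exH : exH.filter (fun e => (0 : Fin 6) ∈ e) = {{0, 3}} := by
  simp [exH, Finset.filter_insert, Finset.filter_singleton]

lemma filter_five_mem_exH : exH.filter (fun e => (5 : Fin 6) ∈ e) = {{2, 5}, {3, 4, 5}} := by
  simp [exH, Finset.filter_insert, Finset.filter_singleton]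

lemma positionValue_exV_exH_zero : positionValue exV exH 0 = 1 / 8 := by
  rw [positionValue_exV_exH, filter_zero_mem_exH, Finset.sum_singleton]
  have h : ({0, 3} : Finset (Fin 6)).card = 2 := rfl
  norm_num [h]

lemma positionValue_exV_exH_five : positionValue exV exH 5 = 5 / 24 := by
  have hne : ({2, 5} : Finset (Fin 6)) ≠ {3, 4, 5} := by decide
  rw [positionValue_exV_exH, filter_five_mem_exH, Finset.sum_pair hne]
  have h₁ : ({2, 5} : Finset (Fin 6)).card = 2 := rfl
  have h₂ : ({3, 4, 5} : Finset (Fin 6)).card = 3 := rfl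
  norm_num [h₁, h₂]

/-- The position value fails balanced conference contributions: in Example 1 the
unweighted conference contribution of player `6` to player `1` is `1/4`, that of
player `1` to player `6` is `5/24`, and these differ. -/
theorem position_value_fails_balanced_conference_contributions :
    (∑ e ∈ exH.filter (fun e => (5 : Fin 6) ∈ e),
        (positionValue exV exH 0 - positionValue exV (exH.erase e) 0)) = 1 / 4
    ∧ (∑ e ∈ exH.filter (fun e => (0 : Fin 6) ∈ e),
        (positionValue exV exH 5 - positionValue exV (exH.erase e) 5)) = 5 / 24
    ∧ ((1 : ℝ) / 4 ≠ 5 / 24) := by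
  have sum_erase (i j : Fin 6) :
      ∑ e ∈ exH.filter (fun e => j ∈ e),
        (positionValue exV exH i - positionValue exV (exH.erase e) i) =
      (exH.filter (fun e => j ∈ e)).card * positionValue exV exH i := by
    rw [← nsmul_eq_mul]
    refine Finset.sum_eq_card_nsmul fun e he => ?_
    rw [positionValue_exV_erase (Finset.mem_filter.1 he).1, sub_zero]
  have hcard : ({{2, 5}, {3, 4, 5}} : Finset (Finset (Fin 6))).card = 2 :=
    Finset.card_pair (by decide)
  refine ⟨?_, ?_, by norm_num⟩
  · rw [sum_erase, positionValue_exV_exH_zero, filter_five_mem_exH, hcard]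
    norm_num
  · rw [sum_erase, positionValue_exV_exH_five, filter_zero_mem_exH]
    simp

end HGGame
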